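/- (Unconditional stability of the implicit difference scheme.) Let m ≥ 2, n ≥ 1, α ∈ (0,1), β ∈ (0,1), γ ∈ (1,2), ω₁ > 0, ω₂ > 0, and let d_{+,i}^{(k)}, d_{-,i}^{(k)}, e_{+,i}^{(k)}, e_{-,i}^{(k)} ≥ 0 be nonnegative reals for i ∈ {1,…,m−1}, k ∈ {1,…,n}. Suppose real numbers ξ_i^{(k)} (i ∈ {0,…,m}, k ∈ {0,…,n}) satisfy ξ_0^{(k)} = ξ_m^{(k)} = 0 for all k, and for all i ∈ {1,…,m−1} and k ∈ {0,…,n−1}: ξ_i^{(k+1)} + ω₁( d_{+,i}^{(k+1)} ∑_{j=0}^{i} g_j^{(β)} ξ_{i−j}^{(k+1)} + d_{-,i}^{(k+1)} ∑_{j=0}^{m−i} g_j^{(β)} ξ_{i+j}^{(k+1)} ) − ω₂( e_{+,i}^{(k+1)} ∑_{j=0}^{i+1} g_j^{(γ)} ξ_{i−j+1}^{(k+1)} + e_{-,i}^{(k+1)} ∑_{j=0}^{m−i+1} g_j^{(γ)} ξ_{i+j−1}^{(k+1)} ) = ξ_i^{(k)} − ∑_{j=1}^{k} a_j ( ξ_i^{(k−j+1)}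 − ξ_i^{(k−j)} ). Then for every k ∈ {0,…,n−1}, max_{1 ≤ i ≤ m−1} |ξ_i^{(k+1)}| ≤ max_{1 ≤ i ≤ m−1} |ξ_i^{(0)}|. -/

import Mathlib

/-- Grünwald coefficient `g_j^(s) = ((-1)^j / j!) * s(s-1)⋯(s-j+1)` (with `g_0 = 1`). -/
noncomputable def grunwald (s : ℝ) (j : ℕ) : ℝ :=
  (-1) ^ j / (Nat.factorial j : ℝ) * ∏ i ∈ Finset.range j, (s - i)

/-- `a_j = (j+1)^(1-α) - j^(1-α)` (real powers). -/
noncomputable def aCoef (α : ℝ) (j : ℕ) : ℝ :=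
  ((j : ℝ) + 1) ^ (1 - α) - (j : ℝ) ^ (1 - α)

theorem grunwald_zero (s : ℝ) : grunwald s 0 = 1 := by simp [grunwald]

theorem grunwald_succ (s : ℝ) (j : ℕ) :
    grunwald s (j + 1) = grunwald s j * ((j - s) / (j + 1)) := by
  have h1 : ((j : ℝ) + 1) ≠ 0 := by positivity
  have h2 : (j.factorial : ℝ) ≠ 0 := by positivity
  simp only [grunwald, Finset.prod_range_succ, Nat.factorial_succ, pow_succ]
  push_cast
  field_simp
  ring

theorem succ_mul_grunwald_succ (s : ℝ) (j : ℕ) :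
    ((j : ℝ) + 1) * grunwald s (j + 1) = -s * grunwald (s - 1) j := by
  induction j with
  | zero => simp [grunwald_succ, grunwald_zero]
  | succ j ih =>
    have h1 : ((j : ℝ) + 1) ≠ 0 := by positivity
    have h2 : ((j : ℝ) + 1 + 1) ≠ 0 := by positivity
    rw [grunwald_succ s (j + 1), grunwald_succ (s - 1) j]
    push_cast
    field_simp
    linear_combination ((j : ℝ) + 1 - s) * ih

/-- Partial sums of Grünwald coefficients are Grünwald coefficients of order `s - 1`. -/
theorem sum_grunwald (s : ℝ) (N : ℕ) :
    ∑ j ∈ Finset.range (N + 1), grunwald s j = grunwald (s - 1) N := by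
  induction N with
  | zero => simp [grunwald_zero]
  | succ N ih =>
    have h1 : ((N : ℝ) + 1) ≠ 0 := by positivity
    rw [Finset.sum_range_succ, ih]
    apply mul_left_cancel₀ h1
    rw [mul_add, succ_mul_grunwald_succ, grunwald_succ (s - 1) N]
    field_simp
    ring

theorem grunwald_nonneg_of_nonpos {s : ℝ} (hs : s ≤ 0) (j : ℕ) : 0 ≤ grunwald s j := by
  induction j with
  | zero => simp [grunwald_zero]
  | succ j ih =>
    rw [grunwald_succ]
    have : (0 : ℝ) ≤ j - s := by have := j.cast_nonneg (α := ℝ); linarith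
    positivity

theorem grunwald_succ_nonpos {s : ℝ} (h0 : 0 ≤ s) (h1 : s ≤ 1) (j : ℕ) :
    grunwald s (j + 1) ≤ 0 := by
  have h := succ_mul_grunwald_succ s j
  have hg := mul_nonneg h0 (grunwald_nonneg_of_nonpos (s := s - 1) (by linarith) j)
  have hj : (0 : ℝ) < (j : ℝ) + 1 := by positivity
  exact nonpos_of_mul_nonpos_right (by linarith : ((j : ℝ) + 1) * _ ≤ 0) hj

theorem grunwald_nonneg_of_ne_one {s : ℝ} (h1 : 1 ≤ s) (h2 : s ≤ 2) {j : ℕ} (hj : j ≠ 1) :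
    0 ≤ grunwald s j := by
  match j, hj with
  | 0, _ => simp [grunwald_zero]
  | j + 2, _ =>
    have h := succ_mul_grunwald_succ s (j + 1)
    have hg := grunwald_succ_nonpos (s := s - 1) (by linarith) (by linarith) j
    have hp : (0 : ℝ) < ((j + 1 : ℕ) : ℝ) + 1 := by positivity
    have : 0 ≤ (((j + 1 : ℕ) : ℝ) + 1) * grunwald s (j + 1 + 1) := by rw [h]; nlinarith
    exact nonneg_of_mul_nonneg_right this hp

theorem aCoef_zero {α : ℝ} (hα : α < 1) : aCoef α 0 = 1 := by
  simp [aCoef, Real.zero_rpow (sub_ne_zero.mpr hα.ne')]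

theorem aCoef_nonneg {α : ℝ} (hα : α ≤ 1) (j : ℕ) : 0 ≤ aCoef α j :=
  sub_nonneg.mpr (Real.rpow_le_rpow (by positivity) (by linarith) (by linarith))

theorem aCoef_succ_le {α : ℝ} (h0 : 0 ≤ α) (h1 : α ≤ 1) (j : ℕ) :
    aCoef α (j + 1) ≤ aCoef α j := by
  have hc := Real.concaveOn_rpow (p := 1 - α) (by linarith) (by linarith)
  have hx : (j : ℝ) ∈ Set.Ici (0 : ℝ) := Set.mem_Ici.mpr (by positivity)
  have hy : (j : ℝ) + 1 + 1 ∈ Set.Ici (0 : ℝ) := Set.mem_Ici.mpr (by positivity)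
  have h := hc.2 hx hy (by norm_num : (0 : ℝ) ≤ 1 / 2) (by norm_num : (0 : ℝ) ≤ 1 / 2)
    (by norm_num)
  simp only [smul_eq_mul] at h
  rw [show 1 / 2 * (j : ℝ) + 1 / 2 * ((j : ℝ) + 1 + 1) = (j : ℝ) + 1 by ring] at h
  simp only [aCoef]
  push_cast
  linarith

/-- Summation by parts: a discrete history term with nonincreasing nonnegative weights is bounded
by the leading weight times the maximum of the history. -/
theorem abs_sub_sum_mul_sub_le {a : ℕ → ℝ} (ha : ∀ j, 0 ≤ a j) (hmono : ∀ j, a (j + 1) ≤ a j)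
    {x : ℕ → ℝ} {C : ℝ} {k : ℕ} (hx : ∀ t ≤ k, |x t| ≤ C) :
    |a 0 * x k - ∑ j ∈ Finset.Icc 1 k, a j * (x (k + 1 - j) - x (k - j))| ≤ a 0 * C := by
  have key : ∀ p, |a 0 * x k - ∑ j ∈ Finset.Icc 1 p, a j * (x (k + 1 - j) - x (k - j))
      - a p * x (k - p)| ≤ (a 0 - a p) * C := by
    intro p
    induction p with
    | zero => simp
    | succ p ih =>
      have hp := hx (k - p) (Nat.sub_le _ _)
      have hm := mul_le_mul_of_nonneg_left hp (sub_nonneg.mpr (hmono p))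
      rw [← abs_of_nonneg (sub_nonneg.mpr (hmono p)), ← abs_mul,
        abs_of_nonneg (sub_nonneg.mpr (hmono p))] at hm
      rw [Finset.sum_Icc_succ_top (by omega), Nat.add_sub_add_right]
      calc _ = |(a 0 * x k - ∑ j ∈ Finset.Icc 1 p, a j * (x (k + 1 - j) - x (k - j))
            - a p * x (k - p)) + (a p - a (p + 1)) * x (k - p)| := by congr 1; ring
        _ ≤ _ := abs_add_le _ _
        _ ≤ (a 0 - a p) * C + (a p - a (p + 1)) * C := add_le_add ih hm
        _ = _ := by ring
  have h1 := key k
  have h2 := mul_le_mul_of_nonneg_left (hx (k - k) (Nat.sub_le _ _)) (ha k)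
  rw [← abs_of_nonneg (ha k), ← abs_mul, abs_of_nonneg (ha k)] at h2
  rw [abs_le] at *
  constructor <;> linarith

/-- At an index where `|x|` is maximal, a weighted sum with nonpositive off-index weights and
nonnegative total weight has the sign of `x` there. -/
theorem sign_mul_sum_nonneg {w x : ℕ → ℝ} {N p : ℕ} {s M : ℝ} (hs : |s| = 1)
    (hw : ∀ j < N, j ≠ p → w j ≤ 0) (hsum : 0 ≤ ∑ j ∈ Finset.range N, w j)
    (hp : s * x p = M) (hM : 0 ≤ M) (hx : ∀ j < N, |x j| ≤ M) :
    0 ≤ s * ∑ j ∈ Finset.range N, w j * x j := by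
  refine (mul_nonneg hsum hM).trans ?_
  rw [Finset.sum_mul, Finset.mul_sum]
  refine Finset.sum_le_sum fun j hj => ?_
  rw [Finset.mem_range] at hj
  rw [mul_left_comm]
  rcases eq_or_ne j p with rfl | hne
  · rw [hp]
  · refine mul_le_mul_of_nonpos_left ?_ (hw j hj hne)
    calc s * x j ≤ |s * x j| := le_abs_self _
      _ = |x j| := by rw [abs_mul, hs, one_mul]
      _ ≤ M := hx j hj

theorem sign_mul_sum_grunwald_nonneg {β : ℝ} (h0 : 0 ≤ β) (h1 : β ≤ 1) {x : ℕ → ℝ} {N : ℕ}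
    {s M : ℝ} (hs : |s| = 1) (hp : s * x 0 = M) (hM : 0 ≤ M) (hx : ∀ j < N + 1, |x j| ≤ M) :
    0 ≤ s * ∑ j ∈ Finset.range (N + 1), grunwald β j * x j := by
  refine sign_mul_sum_nonneg (p := 0) hs (fun j _ hj => ?_) ?_ hp hM hx
  · obtain ⟨j, rfl⟩ := Nat.exists_eq_succ_of_ne_zero hj
    exact grunwald_succ_nonpos h0 h1 j
  · rw [sum_grunwald]
    exact grunwald_nonneg_of_nonpos (by linarith) N

theorem sign_mul_sum_grunwald_nonpos {γ : ℝ} (h1 : 1 ≤ γ) (h2 : γ ≤ 2) {x : ℕ → ℝ} {N : ℕ}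
    {s M : ℝ} (hs : |s| = 1) (hp : s * x 1 = M) (hM : 0 ≤ M) (hx : ∀ j < N + 2, |x j| ≤ M) :
    s * ∑ j ∈ Finset.range (N + 2), grunwald γ j * x j ≤ 0 := by
  have h := sign_mul_sum_nonneg (w := fun j => -grunwald γ j) (p := 1) hs
    (fun j _ hj => neg_nonpos.mpr (grunwald_nonneg_of_ne_one h1 h2 hj)) ?_ hp hM hx
  · simp only [neg_mul, Finset.sum_neg_distrib, mul_neg] at h
    linarith
  · rw [Finset.sum_neg_distrib, sum_grunwald]
    exact neg_nonneg.mpr (grunwald_succ_nonpos (by linarith) (by linarith) N)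

/-- Unconditional stability of the implicit difference scheme: the maximal error at
every time level `k+1` is bounded by the maximal initial error. (Indices: `ξ i k` is
`ξ_i^{(k)}`; subtraction of natural indices such as `i - j + 1` is written `i + 1 - j`
so that it agrees with the integer value on the admissible range.) -/
theorem stmt18 (m n : ℕ) (hm : 2 ≤ m) (hn : 1 ≤ n)
    (α β γ ω₁ ω₂ : ℝ)
    (hα : α ∈ Set.Ioo (0 : ℝ) 1) (hβ : β ∈ Set.Ioo (0 : ℝ) 1)
    (hγ : γ ∈ Set.Ioo (1 : ℝ) 2) (hω₁ : 0 < ω₁) (hω₂ : 0 < ω₂)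
    (dp dm ep em : ℕ → ℕ → ℝ)
    (hdp : ∀ i k, 1 ≤ i → i ≤ m - 1 → 1 ≤ k → k ≤ n → 0 ≤ dp i k)
    (hdm : ∀ i k, 1 ≤ i → i ≤ m - 1 → 1 ≤ k → k ≤ n → 0 ≤ dm i k)
    (hep : ∀ i k, 1 ≤ i → i ≤ m - 1 → 1 ≤ k → k ≤ n → 0 ≤ ep i k)
    (hem : ∀ i k, 1 ≤ i → i ≤ m - 1 → 1 ≤ k → k ≤ n → 0 ≤ em i k)
    (ξ : ℕ → ℕ → ℝ)
    (hbd0 : ∀ k, k ≤ n → ξ 0 k = 0)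
    (hbdm : ∀ k, k ≤ n → ξ m k = 0)
    (hrec : ∀ i k, 1 ≤ i → i ≤ m - 1 → k < n →
      ξ i (k + 1)
        + ω₁ * (dp i (k + 1) * ∑ j ∈ Finset.range (i + 1), grunwald β j * ξ (i - j) (k + 1)
              + dm i (k + 1) * ∑ j ∈ Finset.range (m - i + 1), grunwald β j * ξ (i + j) (k + 1))
        - ω₂ * (ep i (k + 1) * ∑ j ∈ Finset.range (i + 2), grunwald γ j * ξ (i + 1 - j) (k + 1)
              + em i (k + 1) * ∑ j ∈ Finset.range (m - i + 2), grunwald γ j * ξ (i + j - 1) (k + 1))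
      = ξ i k - ∑ j ∈ Finset.Icc 1 k, aCoef α j * (ξ i (k + 1 - j) - ξ i (k - j))) :
    ∀ k, k < n →
      (Finset.Icc 1 (m - 1)).sup' (Finset.nonempty_Icc.mpr (by omega))
          (fun i => |ξ i (k + 1)|) ≤
        (Finset.Icc 1 (m - 1)).sup' (Finset.nonempty_Icc.mpr (by omega))
          (fun i => |ξ i 0|) := by
  set C := (Finset.Icc 1 (m - 1)).sup' (Finset.nonempty_Icc.mpr (by omega))
    (fun i => |ξ i 0|) with hC
  have main : ∀ k, k ≤ n → ∀ i ∈ Finset.Icc 1 (m - 1), |ξ i k| ≤ C := by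
    intro k
    induction k using Nat.strong_induction_on with
    | _ k ih =>
    intro hk
    rcases k with _ | k
    · exact fun i hi => Finset.le_sup' (fun i => |ξ i 0|) hi
    obtain ⟨i, hi, hmax⟩ := Finset.exists_max_image (Finset.Icc 1 (m - 1))
      (fun i => |ξ i (k + 1)|) (Finset.nonempty_Icc.mpr (by omega))
    suffices h : |ξ i (k + 1)| ≤ C from fun l hl => (hmax l hl).trans h
    have hbound : ∀ l ≤ m, |ξ l (k + 1)| ≤ |ξ i (k + 1)| := by
      intro l hl
      rcases Nat.eq_zero_or_pos l with rfl | hl0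
      · rw [hbd0 _ hk, abs_zero]; exact abs_nonneg _
      rcases hl.eq_or_lt with rfl | hlm
      · rw [hbdm _ hk, abs_zero]; exact abs_nonneg _
      · exact hmax l (Finset.mem_Icc.mpr ⟨hl0, by omega⟩)
    obtain ⟨s, hs, hsx⟩ : ∃ s : ℝ, |s| = 1 ∧ s * ξ i (k + 1) = |ξ i (k + 1)| := by
      rcases le_total 0 (ξ i (k + 1)) with h | h
      · exact ⟨1, by simp, by rw [abs_of_nonneg h, one_mul]⟩
      · exact ⟨-1, by simp, by rw [abs_of_nonpos h, neg_one_mul]⟩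
    have hM := abs_nonneg (ξ i (k + 1))
    have hi' := Finset.mem_Icc.mp hi
    have hr := hrec i k hi'.1 hi'.2 hk
    have hR := abs_sub_sum_mul_sub_le (aCoef_nonneg hα.2.le) (aCoef_succ_le hα.1.le hα.2.le)
      (x := ξ i) (C := C) (k := k) (fun t ht => ih t (by omega) (by omega) i hi)
    rw [aCoef_zero hα.2, one_mul, one_mul, ← hr] at hR
    have h1 := mul_nonneg (hdp i (k + 1) hi'.1 hi'.2 (by omega) hk)
      (sign_mul_sum_grunwald_nonneg hβ.1.le hβ.2.le (x := fun j => ξ (i - j) (k + 1)) (N := i)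
        hs hsx hM (fun j _ => hbound _ (by omega)))
    have h2 := mul_nonneg (hdm i (k + 1) hi'.1 hi'.2 (by omega) hk)
      (sign_mul_sum_grunwald_nonneg hβ.1.le hβ.2.le (x := fun j => ξ (i + j) (k + 1))
        (N := m - i) hs hsx hM (fun j _ => hbound _ (by omega)))
    have h3 := mul_nonpos_of_nonneg_of_nonpos (hep i (k + 1) hi'.1 hi'.2 (by omega) hk)
      (sign_mul_sum_grunwald_nonpos hγ.1.le hγ.2.le (x := fun j => ξ (i + 1 - j) (k + 1))
        (N := i) hs hsx hM (fun j _ => hbound _ (by omega)))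
    have h4 := mul_nonpos_of_nonneg_of_nonpos (hem i (k + 1) hi'.1 hi'.2 (by omega) hk)
      (sign_mul_sum_grunwald_nonpos hγ.1.le hγ.2.le (x := fun j => ξ (i + j - 1) (k + 1))
        (N := m - i) hs hsx hM (fun j _ => hbound _ (by omega)))
    have h12 := mul_nonneg hω₁.le (add_nonneg h1 h2)
    have h34 := mul_nonpos_of_nonneg_of_nonpos hω₂.le (add_nonpos h3 h4)
    rw [← one_mul |_ - _|, ← hs, ← abs_mul] at hR
    have hle := (le_abs_self _).trans hR
    linarith
  exact fun k hk => Finset.sup'_le _ _ (main (k + 1) hk)
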